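/- arXiv:1001.1890 — 4 statements merged into one kernel-verified Lean document; each statement's English description precedes it below -/
import Mathlib

section
/- Let {A(k)}_{k≥0} ⊂ 𝕊^m be a deterministic chain of stochastic matrices and let {z(k)} be generated by z(k+1) = A(k)z(k) for all k ≥ 0 from an initial state z(0) ∈ ℝ^m. Then for every nonempty proper subset S ⊂ {1,…,m} and every k ≥ 0: max_{i∈S} z_i(k+1) ≤ max_{s∈S} z_s(0) + d(z(0))·Σ_{t=0}^{k} A_S(t), and min_{j∈S̄} z_j(k+1) ≥ min_{r∈S̄} z_r(0) − d(z(0))·Σ_{t=0}^{k} A_S(t), where d(y) = max_{ℓ∈[m]} y_ℓ − min_{r∈[m]} y_r and S̄ is the complement of S in {1,…,m}. -/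
open Filter MeasureTheory ProbabilityTheory Matrix

/-- An `m × m` real matrix is (row-)stochastic if all entries are nonnegative
and each row sums to `1`. -/
def IsStochastic {m : ℕ} (A : Matrix (Fin m) (Fin m) ℝ) : Prop :=
  (∀ i j, 0 ≤ A i j) ∧ ∀ i, ∑ j, A i j = 1

/-- The flow `W_S = Σ_{i∈S, j∉S} (W_{ij} + W_{ji})` across the cut `(S, Sᶜ)`. -/
noncomputable def flowAcross {m : ℕ} (A : Matrix (Fin m) (Fin m) ℝ) (S : Finset (Fin m)) : ℝ :=
  ∑ i ∈ S, ∑ j ∈ Sᶜ, (A i j + A j i)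

/-- `Phi A k t = A(k) A(k-1) ⋯ A(t)` (for `k ≥ t`). -/
noncomputable def Phi {m : ℕ} (A : ℕ → Matrix (Fin m) (Fin m) ℝ) (k t : ℕ) :
    Matrix (Fin m) (Fin m) ℝ :=
  ((List.range (k + 1 - t)).map (fun i => A (k - i))).prod

/-- A deterministic chain `{A(k)}` is ergodic if for every `t` and `j` there is a scalar
`g_j(t)` such that `Φ_{ij}(k,t) → g_j(t)` as `k → ∞`, for all `i`. -/
def IsErgodicChain {m : ℕ} (A : ℕ → Matrix (Fin m) (Fin m) ℝ) : Prop :=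
  ∀ t : ℕ, ∀ j : Fin m, ∃ g : ℝ, ∀ i : Fin m,
    Tendsto (fun k => Phi A k t i j) atTop (nhds g)

/-- The trajectory `z(k+1) = A(k) z(k)` started from `z0`. -/
noncomputable def traj {m : ℕ} (A : ℕ → Matrix (Fin m) (Fin m) ℝ) (z0 : Fin m → ℝ) :
    ℕ → Fin m → ℝ
  | 0 => z0
  | k + 1 => (A k).mulVec (traj A z0 k)

/-- A deterministic chain reaches a consensus if for every initial state the trajectory
converges to a multiple of the all-ones vector. -/
def ReachesConsensus {m : ℕ} (A : ℕ → Matrix (Fin m) (Fin m) ℝ) : Prop :=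
  ∀ z0 : Fin m → ℝ, ∃ c : ℝ,
    Tendsto (fun k => traj A z0 k) atTop (nhds (fun _ => c))

/-- `SumInf f` says that `Σ_{k=0}^∞ f(k) = ∞` (partial sums tend to infinity). -/
def SumInf (f : ℕ → ℝ) : Prop :=
  Tendsto (fun n => ∑ k ∈ Finset.range n, f k) atTop atTop

/-- A chain has the infinite flow property if `Σ_k A_S(k) = ∞` for every nonempty
proper subset `S` of the index set. -/
def InfiniteFlow {m : ℕ} (A : ℕ → Matrix (Fin m) (Fin m) ℝ) : Prop :=
  ∀ S : Finset (Fin m), S.Nonempty → S ≠ Finset.univ →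
    SumInf (fun k => flowAcross (A k) S)

/-- Borel measurable structure on matrices (entrywise, i.e. as `Fin m → Fin n → ℝ`). -/
instance matrixMeasurableSpace {m n : ℕ} : MeasurableSpace (Matrix (Fin m) (Fin n) ℝ) :=
  (inferInstance : MeasurableSpace (Fin m → Fin n → ℝ))

/-- The random trajectory `x(k+1) = W(k) x(k)` started from the deterministic `x0`. -/
noncomputable def rtraj {m : ℕ} {Ω : Type*} (W : ℕ → Ω → Matrix (Fin m) (Fin m) ℝ)
    (x0 : Fin m → ℝ) : ℕ → Ω → Fin m → ℝ
  | 0 => fun _ => x0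
  | k + 1 => fun ω => (W k ω).mulVec (rtraj W x0 k ω)

/-- `V(x) = Σ_i π_i (x_i - π^T x)^2`. -/
noncomputable def Vlyap {m : ℕ} (π x : Fin m → ℝ) : ℝ :=
  ∑ i, π i * (x i - ∑ j, π j * x j) ^ 2

theorem flowAcross_compl {m : ℕ} (A : Matrix (Fin m) (Fin m) ℝ) (S : Finset (Fin m)) :
    flowAcross A Sᶜ = flowAcross A S := by
  unfold flowAcross
  rw [compl_compl, Finset.sum_comm]
  exact Finset.sum_congr rfl fun i _ => Finset.sum_congr rfl fun j _ => add_comm _ _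

theorem traj_neg {m : ℕ} (A : ℕ → Matrix (Fin m) (Fin m) ℝ) (z0 : Fin m → ℝ) (k : ℕ) :
    traj A (-z0) k = -traj A z0 k := by
  induction k with
  | zero => rfl
  | succ k ih => simp only [traj, ih, Matrix.mulVec_neg]

theorem IsStochastic.mulVec_le {m : ℕ} {A : Matrix (Fin m) (Fin m) ℝ} (hA : IsStochastic A)
    {x : Fin m → ℝ} {U : ℝ} (hx : ∀ i, x i ≤ U) (i : Fin m) : A.mulVec x i ≤ U :=
  calc A.mulVec x i = ∑ j, A i j * x j := rfl
    _ ≤ ∑ j, A i j * U :=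
        Finset.sum_le_sum fun j _ => mul_le_mul_of_nonneg_left (hx j) (hA.1 i j)
    _ = U := by rw [← Finset.sum_mul, hA.2, one_mul]

theorem traj_le {m : ℕ} {A : ℕ → Matrix (Fin m) (Fin m) ℝ} (hA : ∀ k, IsStochastic (A k))
    {z0 : Fin m → ℝ} {U : ℝ} (hz : ∀ i, z0 i ≤ U) (k : ℕ) (i : Fin m) : traj A z0 k i ≤ U := by
  induction k generalizing i with
  | zero => exact hz i
  | succ k ih => exact (hA k).mulVec_le ih i

theorem le_traj {m : ℕ} {A : ℕ → Matrix (Fin m) (Fin m) ℝ} (hA : ∀ k, IsStochastic (A k))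
    {z0 : Fin m → ℝ} {L : ℝ} (hz : ∀ i, L ≤ z0 i) (k : ℕ) (i : Fin m) : L ≤ traj A z0 k i := by
  have h := traj_le hA (z0 := -z0) (fun i => neg_le_neg (hz i)) k i
  rw [traj_neg] at h
  exact neg_le_neg_iff.mp h

theorem IsStochastic.sum_compl_le_flowAcross {m : ℕ} {A : Matrix (Fin m) (Fin m) ℝ}
    (hA : IsStochastic A) {S : Finset (Fin m)} {i : Fin m} (hi : i ∈ S) :
    ∑ j ∈ Sᶜ, A i j ≤ flowAcross A S :=
  calc ∑ j ∈ Sᶜ, A i j ≤ ∑ j ∈ Sᶜ, (A i j + A j i) :=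
        Finset.sum_le_sum fun j _ => le_add_of_nonneg_right (hA.1 j i)
    _ ≤ flowAcross A S :=
        Finset.single_le_sum (f := fun i => ∑ j ∈ Sᶜ, (A i j + A j i))
          (fun i _ => Finset.sum_nonneg fun j _ => add_nonneg (hA.1 i j) (hA.1 j i)) hi

/-- If the entries of `x` lie in `[L, U]` and are at most `b` on `S`, then averaging by a
stochastic matrix raises the bound on `S` by at most `U - L` times the flow across the cut. -/
theorem IsStochastic.mulVec_le_add_flowAcross {m : ℕ} {A : Matrix (Fin m) (Fin m) ℝ}
    (hA : IsStochastic A) {S : Finset (Fin m)} {x : Fin m → ℝ} {L U b : ℝ}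
    (hL : ∀ i, L ≤ x i) (hU : ∀ i, x i ≤ U) (hb : ∀ i ∈ S, x i ≤ b) {i : Fin m} (hi : i ∈ S) :
    A.mulVec x i ≤ b + (U - L) * flowAcross A S := by
  have hin : ∑ j ∈ S, A i j * x j ≤ (∑ j ∈ S, A i j) * b := by
    rw [Finset.sum_mul]
    exact Finset.sum_le_sum fun j hj => mul_le_mul_of_nonneg_left (hb j hj) (hA.1 i j)
  have hout : ∑ j ∈ Sᶜ, A i j * x j ≤ (∑ j ∈ Sᶜ, A i j) * U := by
    rw [Finset.sum_mul]
    exact Finset.sum_le_sum fun j _ => mul_le_mul_of_nonneg_left (hU j) (hA.1 i j)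
  have hrow : ∑ j ∈ S, A i j = 1 - ∑ j ∈ Sᶜ, A i j := by
    rw [eq_sub_iff_add_eq, Finset.sum_add_sum_compl, hA.2]
  have hsum : A.mulVec x i = ∑ j ∈ S, A i j * x j + ∑ j ∈ Sᶜ, A i j * x j :=
    (Finset.sum_add_sum_compl S _).symm
  have hflow := mul_le_mul_of_nonneg_left (hA.sum_compl_le_flowAcross hi)
    (sub_nonneg.mpr ((hL i).trans (hU i)))
  have hLb : 0 ≤ (∑ j ∈ Sᶜ, A i j) * (b - L) :=
    mul_nonneg (Finset.sum_nonneg fun j _ => hA.1 i j)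
      (sub_nonneg.mpr ((hL i).trans (hb i hi)))
  rw [hrow] at hin
  rw [hsum]
  linarith

theorem traj_le_add_sum_flowAcross {m : ℕ} {A : ℕ → Matrix (Fin m) (Fin m) ℝ}
    (hA : ∀ k, IsStochastic (A k)) {z0 : Fin m → ℝ} {S : Finset (Fin m)} {L U b : ℝ}
    (hL : ∀ i, L ≤ z0 i) (hU : ∀ i, z0 i ≤ U) (hb : ∀ i ∈ S, z0 i ≤ b) (k : ℕ)
    {i : Fin m} (hi : i ∈ S) :
    traj A z0 k i ≤ b + (U - L) * ∑ t ∈ Finset.range k, flowAcross (A t) S := by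
  induction k generalizing i with
  | zero => simpa [traj] using hb i hi
  | succ k ih =>
    rw [Finset.sum_range_succ, mul_add, ← add_assoc]
    exact (hA k).mulVec_le_add_flowAcross (le_traj hA hL k) (traj_le hA hU k)
      (fun j hj => ih hj) hi

theorem sub_sum_flowAcross_le_traj {m : ℕ} {A : ℕ → Matrix (Fin m) (Fin m) ℝ}
    (hA : ∀ k, IsStochastic (A k)) {z0 : Fin m → ℝ} {S : Finset (Fin m)} {L U b : ℝ}
    (hL : ∀ i, L ≤ z0 i) (hU : ∀ i, z0 i ≤ U) (hb : ∀ i ∈ Sᶜ, b ≤ z0 i) (k : ℕ)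
    {i : Fin m} (hi : i ∈ Sᶜ) :
    b - (U - L) * ∑ t ∈ Finset.range k, flowAcross (A t) S ≤ traj A z0 k i := by
  have h := traj_le_add_sum_flowAcross hA (z0 := -z0) (fun i => neg_le_neg (hU i))
    (fun i => neg_le_neg (hL i)) (fun i hi => neg_le_neg (hb i hi)) k hi
  simp only [traj_neg, flowAcross_compl, Pi.neg_apply] at h
  linarith

/-- Lemma 1: bounds on `max_{i∈S} z_i(k+1)` and `min_{j∈S̄} z_j(k+1)` in terms of the
initial spread `d(z(0))` and the accumulated flow across the cut `(S, S̄)`. -/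
theorem stmt0 {m : ℕ} [NeZero m] (A : ℕ → Matrix (Fin m) (Fin m) ℝ)
    (hA : ∀ k, IsStochastic (A k)) (z0 : Fin m → ℝ)
    (S : Finset (Fin m)) (hS : S.Nonempty) (hSc : Sᶜ.Nonempty) (k : ℕ) :
    S.sup' hS (traj A z0 (k + 1)) ≤
      S.sup' hS z0 +
        (Finset.univ.sup' Finset.univ_nonempty z0 -
            Finset.univ.inf' Finset.univ_nonempty z0) *
          ∑ t ∈ Finset.range (k + 1), flowAcross (A t) S ∧
    Sᶜ.inf' hSc z0 -
        (Finset.univ.sup' Finset.univ_nonempty z0 -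
            Finset.univ.inf' Finset.univ_nonempty z0) *
          ∑ t ∈ Finset.range (k + 1), flowAcross (A t) S ≤
      Sᶜ.inf' hSc (traj A z0 (k + 1)) := by
  have hL : ∀ i, Finset.univ.inf' Finset.univ_nonempty z0 ≤ z0 i :=
    fun i => Finset.inf'_le z0 (Finset.mem_univ i)
  have hU : ∀ i, z0 i ≤ Finset.univ.sup' Finset.univ_nonempty z0 :=
    fun i => Finset.le_sup' z0 (Finset.mem_univ i)
  exact ⟨Finset.sup'_le hS _ fun i hi => traj_le_add_sum_flowAcross hA hL hU
      (fun j hj => Finset.le_sup' z0 hj) (k + 1) hi,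
    Finset.le_inf' hSc _ fun i hi => sub_sum_flowAcross_le_traj hA hL hU
      (fun j hj => Finset.inf'_le z0 hj) (k + 1) hi⟩
end

section
/- Let {A(k)}_{k≥0} ⊂ 𝕊^m be a deterministic chain of stochastic matrices that is ergodic. Then Σ_{k=0}^{∞} A_S(k) = ∞ for every nonempty proper subset S ⊂ {1,…,m}; that is, every ergodic chain has the infinite flow property. -/
open Filter MeasureTheory ProbabilityTheory Matrix

theorem Phi_self {m : ℕ} (A : ℕ → Matrix (Fin m) (Fin m) ℝ) (t : ℕ) : Phi A t t = A t := by
  simp [Phi]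

theorem Phi_succ {m : ℕ} (A : ℕ → Matrix (Fin m) (Fin m) ℝ) {k t : ℕ} (h : t ≤ k) :
    Phi A (k + 1) t = A (k + 1) * Phi A k t := by
  have e : k + 1 + 1 - t = (k + 1 - t) + 1 := by omega
  simp only [Phi, e, List.range_succ_eq_map, List.map_cons, List.map_map, List.prod_cons,
    Nat.sub_zero]
  congr 3
  funext i
  simp only [Function.comp_apply, Nat.succ_eq_add_one, Nat.add_sub_add_right]

theorem IsStochastic.mul {m : ℕ} {A B : Matrix (Fin m) (Fin m) ℝ} (hA : IsStochastic A)
    (hB : IsStochastic B) : IsStochastic (A * B) := by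
  refine ⟨fun i j => ?_, fun i => ?_⟩
  · rw [Matrix.mul_apply]
    exact Finset.sum_nonneg fun l _ => mul_nonneg (hA.1 i l) (hB.1 l j)
  · simp only [Matrix.mul_apply]
    rw [Finset.sum_comm]
    simp only [← Finset.mul_sum, hB.2, mul_one, hA.2]

theorem IsStochastic.Phi {m : ℕ} {A : ℕ → Matrix (Fin m) (Fin m) ℝ}
    (hA : ∀ k, IsStochastic (A k)) {k t : ℕ} (h : t ≤ k) : IsStochastic (Phi A k t) := by
  induction k, h using Nat.le_induction with
  | base => rw [Phi_self]; exact hA t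
  | succ k h ih => rw [Phi_succ A h]; exact (hA _).mul ih

theorem IsStochastic.flowAcross_nonneg {m : ℕ} {A : Matrix (Fin m) (Fin m) ℝ}
    (hA : IsStochastic A) (S : Finset (Fin m)) : 0 ≤ flowAcross A S :=
  Finset.sum_nonneg fun i _ => Finset.sum_nonneg fun j _ => add_nonneg (hA.1 i j) (hA.1 j i)

/-- A row indexed in `S` keeps all of its mass inside `S` except for at most the flow. -/
theorem IsStochastic.one_sub_flowAcross_le {m : ℕ} {A : Matrix (Fin m) (Fin m) ℝ}
    (hA : IsStochastic A) {S : Finset (Fin m)} {i : Fin m} (hi : i ∈ S) :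
    1 - flowAcross A S ≤ ∑ j ∈ S, A i j := by
  have h1 : ∑ j ∈ Sᶜ, (A i j + A j i) ≤ flowAcross A S :=
    Finset.single_le_sum (f := fun i => ∑ j ∈ Sᶜ, (A i j + A j i))
      (fun i _ => Finset.sum_nonneg fun j _ => add_nonneg (hA.1 i j) (hA.1 j i)) hi
  have h2 : ∑ j ∈ Sᶜ, A i j ≤ ∑ j ∈ Sᶜ, (A i j + A j i) :=
    Finset.sum_le_sum fun j _ => le_add_of_nonneg_right (hA.1 j i)
  have h3 := Finset.sum_add_sum_compl S (A i)
  rw [hA.2 i] at h3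
  linarith

/-- The mass kept inside `S` by a product is controlled by the accumulated flow. -/
theorem one_sub_sum_flowAcross_le_sum_Phi {m : ℕ} {A : ℕ → Matrix (Fin m) (Fin m) ℝ}
    (hA : ∀ k, IsStochastic (A k)) (S : Finset (Fin m)) {k t : ℕ} (h : t ≤ k) :
    ∀ i ∈ S, 1 - ∑ l ∈ Finset.Ico t (k + 1), flowAcross (A l) S ≤ ∑ j ∈ S, Phi A k t i j := by
  induction k, h using Nat.le_induction with
  | base =>
    intro i hi
    simpa [Phi_self] using (hA t).one_sub_flowAcross_le hi
  | succ k h ih =>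
    intro i hi
    rw [Finset.sum_Ico_succ_top (by omega)]
    set s := ∑ l ∈ Finset.Ico t (k + 1), flowAcross (A l) S
    have hs : 0 ≤ s := Finset.sum_nonneg fun l _ => (hA l).flowAcross_nonneg S
    have hrow := (hA (k + 1)).one_sub_flowAcross_le hi
    have hrow_le : ∑ l ∈ S, A (k + 1) i l ≤ 1 := by
      rw [← (hA (k + 1)).2 i]
      exact Finset.sum_le_univ_sum_of_nonneg ((hA (k + 1)).1 i)
    have hP := IsStochastic.Phi hA h
    calc 1 - (s + flowAcross (A (k + 1)) S)
        ≤ (∑ l ∈ S, A (k + 1) i l) * (1 - s) := by nlinarith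
      _ = ∑ l ∈ S, A (k + 1) i l * (1 - s) := Finset.sum_mul ..
      _ ≤ ∑ l ∈ S, A (k + 1) i l * ∑ j ∈ S, Phi A k t l j :=
          Finset.sum_le_sum fun l hl => mul_le_mul_of_nonneg_left (ih l hl) ((hA _).1 i l)
      _ ≤ ∑ l, A (k + 1) i l * ∑ j ∈ S, Phi A k t l j :=
          Finset.sum_le_univ_sum_of_nonneg fun l =>
            mul_nonneg ((hA _).1 i l) (Finset.sum_nonneg fun j _ => hP.1 l j)
      _ = ∑ j ∈ S, Phi A (k + 1) t i j := by
          simp only [Phi_succ A h, Matrix.mul_apply, Finset.mul_sum]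
          exact Finset.sum_comm

/-- Theorem 1: every ergodic deterministic chain of stochastic matrices has the
infinite flow property: `Σ_k A_S(k) = ∞` for every nonempty proper `S ⊂ [m]`. -/
theorem stmt1 {m : ℕ} (A : ℕ → Matrix (Fin m) (Fin m) ℝ)
    (hA : ∀ k, IsStochastic (A k)) (hErg : IsErgodicChain A) :
    InfiniteFlow A := by
  intro S ⟨a, ha⟩ hS
  obtain ⟨b, hb⟩ : ∃ b, b ∈ Sᶜ := by
    by_contra! hne
    exact hS (by simpa using Finset.eq_empty_of_forall_notMem hne)
  have hf : ∀ k, 0 ≤ flowAcross (A k) S := fun k => (hA k).flowAcross_nonneg S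
  by_contra hinf
  have hsum : Summable fun k => flowAcross (A k) S := by
    by_contra hns
    exact hinf ((not_summable_iff_tendsto_nat_atTop_of_nonneg hf).1 hns)
  obtain ⟨t, ht⟩ : ∃ t, ∀ k, ∑ l ∈ Finset.Ico t (k + 1), flowAcross (A l) S ≤ 1 / 4 := by
    have htail := tendsto_sum_nat_add fun k => flowAcross (A k) S
    obtain ⟨t, ht⟩ := (htail.eventually_le_const (show (0 : ℝ) < 1 / 4 by norm_num)).exists
    refine ⟨t, fun k => ?_⟩
    rw [Finset.sum_Ico_eq_sum_range]
    simp only [add_comm t]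
    exact (((summable_nat_add_iff t).2 hsum).sum_le_tsum _ fun l _ => hf (l + t)).trans ht
  choose g hg using hErg t
  have hlim : ∀ (T : Finset (Fin m)) (i : Fin m),
      Tendsto (fun k => ∑ j ∈ T, Phi A k t i j) atTop (nhds (∑ j ∈ T, g j)) :=
    fun T i => tendsto_finsetSum T fun j _ => hg j i
  have hS_ge : 3 / 4 ≤ ∑ j ∈ S, g j := by
    refine ge_of_tendsto (hlim S a) ((eventually_ge_atTop t).mono fun k hk => ?_)
    linarith [one_sub_sum_flowAcross_le_sum_Phi hA S hk a ha, ht k]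
  have hSc_ge : 3 / 4 ≤ ∑ j ∈ Sᶜ, g j := by
    refine ge_of_tendsto (hlim Sᶜ b) ((eventually_ge_atTop t).mono fun k hk => ?_)
    have hb_le := one_sub_sum_flowAcross_le_sum_Phi hA Sᶜ hk b hb
    simp only [flowAcross_compl] at hb_le
    linarith [ht k]
  have hone : ∑ j, g j ≤ 1 := by
    refine le_of_tendsto (hlim Finset.univ a) ((eventually_ge_atTop t).mono fun k hk => ?_)
    exact ((IsStochastic.Phi hA hk).2 a).le
  linarith [Finset.sum_add_sum_compl S g]
end

section
/- Let {W(k)}_{k≥0} be a (not necessarily independent) random model such that each matrix W(k) is invertible almost surely. Then the ergodicity event and the consensus event coincide almost surely: Pr(ℰ Δ 𝒞) = 0, i.e., ℰ = 𝒞 up to a null set. -/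
open Filter MeasureTheory ProbabilityTheory Matrix

/-- The flow property of trajectories: `z(k+1) = Φ(k,t) z(t)`. -/
theorem traj_succ_eq_Phi_mulVec {m : ℕ} (A : ℕ → Matrix (Fin m) (Fin m) ℝ) (z0 : Fin m → ℝ)
    {k t : ℕ} (h : t ≤ k) : traj A z0 (k + 1) = (Phi A k t).mulVec (traj A z0 t) := by
  induction k, h using Nat.le_induction with
  | base => rw [Phi_self, traj]
  | succ k h ih => rw [traj, ih, Phi_succ A h, Matrix.mulVec_mulVec]

/-- If all matrices are invertible, every state at time `t` is reached from some initial state. -/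
theorem exists_traj_eq {m : ℕ} {A : ℕ → Matrix (Fin m) (Fin m) ℝ} (hA : ∀ k, (A k).det ≠ 0)
    (t : ℕ) (y : Fin m → ℝ) : ∃ z0, traj A z0 t = y := by
  induction t generalizing y with
  | zero => exact ⟨y, rfl⟩
  | succ t ih =>
    obtain ⟨z0, hz⟩ := ih ((A t)⁻¹.mulVec y)
    refine ⟨z0, ?_⟩
    rw [traj, hz, Matrix.mulVec_mulVec, Matrix.mul_nonsing_inv _ (isUnit_iff_ne_zero.mpr (hA t)),
      Matrix.one_mulVec]

theorem IsErgodicChain.reachesConsensus {m : ℕ} {A : ℕ → Matrix (Fin m) (Fin m) ℝ}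
    (h : IsErgodicChain A) : ReachesConsensus A := by
  intro z0
  choose g hg using h 0
  refine ⟨∑ j, g j * z0 j, (tendsto_add_atTop_iff_nat 1).mp (tendsto_pi_nhds.mpr fun i => ?_)⟩
  simp only [traj_succ_eq_Phi_mulVec A z0 (Nat.zero_le _)]
  exact tendsto_finsetSum _ fun j _ => (hg j i).mul_const (z0 j)

theorem ReachesConsensus.isErgodicChain {m : ℕ} {A : ℕ → Matrix (Fin m) (Fin m) ℝ}
    (hA : ∀ k, (A k).det ≠ 0) (h : ReachesConsensus A) : IsErgodicChain A := by
  intro t j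
  obtain ⟨z0, hz⟩ := exists_traj_eq hA t (Pi.single j 1)
  obtain ⟨c, hc⟩ := h z0
  refine ⟨c, fun i => ?_⟩
  refine (tendsto_pi_nhds.mp ((tendsto_add_atTop_iff_nat 1).mpr hc) i).congr' ?_
  filter_upwards [eventually_ge_atTop t] with k hk
  rw [traj_succ_eq_Phi_mulVec A z0 hk, hz, Matrix.mulVec_single_one, Matrix.col_apply]

/-- Lemma 2: for a random model whose matrices are almost surely invertible, the
ergodicity event and the consensus event coincide up to a null set. -/
theorem stmt2 {m : ℕ} {Ω : Type*} [MeasurableSpace Ω] (μ : Measure Ω)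
    [IsProbabilityMeasure μ] (W : ℕ → Ω → Matrix (Fin m) (Fin m) ℝ)
    (hmeas : ∀ k, Measurable (W k)) (hstoch : ∀ k ω, IsStochastic (W k ω))
    (hinv : ∀ k, ∀ᵐ ω ∂μ, (W k ω).det ≠ 0) :
    μ (({ω | IsErgodicChain fun k => W k ω} \ {ω | ReachesConsensus fun k => W k ω}) ∪
        ({ω | ReachesConsensus fun k => W k ω} \ {ω | IsErgodicChain fun k => W k ω})) = 0 := by
  refine measure_mono_null ?_ (ae_iff.mp (ae_all_iff.mpr hinv))
  rintro ω (⟨he, hc⟩ | ⟨hc, he⟩) hA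
  · exact hc (IsErgodicChain.reachesConsensus he)
  · exact he (ReachesConsensus.isErgodicChain hA hc)
end

section
/- Let π ∈ ℝ^m be a stochastic vector and let x ∈ ℝ^m satisfy x_1 ≤ x_2 ≤ ⋯ ≤ x_m with x_1 < x_m. Then (1/(m−1)^2)·V(x) ≤ (1/(x_m − x_1))·Σ_{i=1}^{m−1} (x_{i+1} − x_i)^3, where V(x) = Σ_{i=1}^m π_i (x_i − π^T x)^2. -/
open Filter MeasureTheory ProbabilityTheory Matrix

/-- A sum of consecutive differences telescopes. -/
theorem sum_succ_sub_castSucc {n : ℕ} (g : Fin (n + 1) → ℝ) :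
    ∑ i : Fin n, (g i.succ - g i.castSucc) = g (Fin.last n) - g 0 := by
  rw [Finset.sum_sub_distrib]
  linarith [Fin.sum_univ_succ g, Fin.sum_univ_castSucc g]

/-- A weighted variance is at most the square of the length of an interval containing the data. -/
theorem Vlyap_le_sq_sub {m : ℕ} {π x : Fin m → ℝ} {a b : ℝ}
    (hπ0 : ∀ i, 0 ≤ π i) (hπ1 : ∑ i, π i = 1) (ha : ∀ i, a ≤ x i) (hb : ∀ i, x i ≤ b) :
    Vlyap π x ≤ (b - a) ^ 2 := by
  have hlow : a ≤ ∑ j, π j * x j := by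
    calc a = ∑ j, π j * a := by rw [← Finset.sum_mul, hπ1, one_mul]
      _ ≤ _ := Finset.sum_le_sum fun j _ => mul_le_mul_of_nonneg_left (ha j) (hπ0 j)
  have hupp : ∑ j, π j * x j ≤ b := by
    calc _ ≤ ∑ j, π j * b :=
          Finset.sum_le_sum fun j _ => mul_le_mul_of_nonneg_left (hb j) (hπ0 j)
      _ = b := by rw [← Finset.sum_mul, hπ1, one_mul]
  calc Vlyap π x ≤ ∑ i, π i * (b - a) ^ 2 :=
        Finset.sum_le_sum fun i _ => mul_le_mul_of_nonneg_left
          (sq_le_sq' (by linarith [ha i]) (by linarith [hb i])) (hπ0 i)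
    _ = (b - a) ^ 2 := by rw [← Finset.sum_mul, hπ1, one_mul]

/-- Lemma 10: for a stochastic vector `π` and a nondecreasing vector `x` with
`x_1 < x_m`, `(1/(m-1)^2) V(x) ≤ (1/(x_m - x_1)) Σ_{i=1}^{m-1} (x_{i+1} - x_i)^3`. -/
theorem stmt15 {m : ℕ} (hm : 2 ≤ m) (π x : Fin m → ℝ)
    (hπ0 : ∀ i, 0 ≤ π i) (hπ1 : ∑ i, π i = 1)
    (hmono : Monotone x) (hlt : x ⟨0, by omega⟩ < x ⟨m - 1, by omega⟩) :
    (1 / ((m : ℝ) - 1) ^ 2) * Vlyap π x ≤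
      (1 / (x ⟨m - 1, by omega⟩ - x ⟨0, by omega⟩)) *
        ∑ i : Fin (m - 1),
          (x (Fin.cast (by omega) i.succ) - x (Fin.cast (by omega) i.castSucc)) ^ 3 := by
  obtain ⟨n, rfl⟩ : ∃ n, m = n + 1 := ⟨m - 1, by omega⟩
  have hn : (0 : ℝ) < n := by exact_mod_cast (by omega : 0 < n)
  change x 0 < x (Fin.last n) at hlt
  change _ ≤ 1 / (x (Fin.last n) - x 0) * ∑ i : Fin n, (x i.succ - x i.castSucc) ^ 3
  have hV := Vlyap_le_sq_sub hπ0 hπ1 (fun i => hmono (Fin.zero_le i))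
    (fun i => hmono (Fin.le_last i))
  have hpow := pow_sum_div_card_le_sum_pow (s := Finset.univ)
    (f := fun i : Fin n => x i.succ - x i.castSucc)
    (fun i _ => sub_nonneg.2 (hmono i.castSucc_lt_succ.le)) 2
  have hD : 0 < x (Fin.last n) - x 0 := sub_pos.2 hlt
  rw [sum_succ_sub_castSucc, Finset.card_univ, Fintype.card_fin] at hpow
  push_cast
  rw [add_sub_cancel_right]
  calc 1 / (n : ℝ) ^ 2 * Vlyap π x ≤ 1 / (n : ℝ) ^ 2 * (x (Fin.last n) - x 0) ^ 2 := by gcongr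
    _ = 1 / (x (Fin.last n) - x 0) * ((x (Fin.last n) - x 0) ^ 3 / (n : ℝ) ^ 2) := by
        field_simp
    _ ≤ _ := by gcongr
end
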